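/- Let γ₁ < γ₂ both lie in the Bohl resolvent ϱ_B(A). Then [γ₁,γ₂] ⊆ ϱ_B(A) if and only if M_{γ₁} = M_{γ₂}, where M_γ = {x₀ ≠ 0 : β̄_A(x₀) < γ} ∪ {0}. -/

import Mathlib

open Filter Topology

noncomputable section

abbrev Euc (d : ℕ) := EuclideanSpace ℝ (Fin d)

/-- forward product `A(m+k-1) ⋯ A(m)` -/
def fwd {d : ℕ} (A : ℕ → (Euc d →L[ℝ] Euc d)) (m : ℕ) : ℕ → (Euc d →L[ℝ] Euc d)
  | 0 => 1
  | k + 1 => A (m + k) * fwd A m k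

/-- backward product `Ainv(n) ⋯ Ainv(n+k-1)` -/
def bwd {d : ℕ} (Ainv : ℕ → (Euc d →L[ℝ] Euc d)) (n : ℕ) : ℕ → (Euc d →L[ℝ] Euc d)
  | 0 => 1
  | k + 1 => bwd Ainv n k * Ainv (n + k)

/-- transition matrix Φ_A(n,m) -/
def Phi {d : ℕ} (A Ainv : ℕ → (Euc d →L[ℝ] Euc d)) (n m : ℕ) : Euc d →L[ℝ] Euc d :=
  if m ≤ n then fwd A m (n - m) else bwd Ainv n (m - n)

/-- A is a bounded sequence of invertible maps with bounded inverse sequence Ainv -/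
def IsLyapunov {d : ℕ} (A Ainv : ℕ → (Euc d →L[ℝ] Euc d)) : Prop :=
  (∀ n, A n * Ainv n = 1) ∧ (∀ n, Ainv n * A n = 1) ∧
    BddAbove (Set.range fun n => ‖A n‖) ∧ BddAbove (Set.range fun n => ‖Ainv n‖)

/-- `‖A‖_∞ = sup_n ‖A(n)‖` -/
def supNorm {d : ℕ} (A : ℕ → (Euc d →L[ℝ] Euc d)) : ℝ := ⨆ n, ‖A n‖

/-- solution `x(n,x₀) = Φ_A(n,0) x₀` -/
def sol {d : ℕ} (A : ℕ → (Euc d →L[ℝ] Euc d)) (n : ℕ) (x₀ : Euc d) : Euc d :=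
  fwd A 0 n x₀

/-- `λ(n,m) = (1/(n-m)) ln (‖x(n,x₀)‖ / ‖x(m,x₀)‖)` -/
def lam {d : ℕ} (A : ℕ → (Euc d →L[ℝ] Euc d)) (n m : ℕ) (x₀ : Euc d) : ℝ :=
  Real.log (‖sol A n x₀‖ / ‖sol A m x₀‖) / ((n : ℝ) - (m : ℝ))

/-- upper Bohl exponent of a subspace -/
def upperBohl {d : ℕ} (A : ℕ → (Euc d →L[ℝ] Euc d)) (L : Set (Euc d)) : ℝ :=
  ⨅ N : ℕ, sSup {r | ∃ n m : ℕ, ∃ x₀ : Euc d,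
    N < n - m ∧ x₀ ∈ L ∧ x₀ ≠ 0 ∧ r = lam A n m x₀}

/-- lower Bohl exponent of a subspace -/
def lowerBohl {d : ℕ} (A : ℕ → (Euc d →L[ℝ] Euc d)) (L : Set (Euc d)) : ℝ :=
  ⨆ N : ℕ, sInf {r | ∃ n m : ℕ, ∃ x₀ : Euc d,
    N < n - m ∧ x₀ ∈ L ∧ x₀ ≠ 0 ∧ r = lam A n m x₀}

/-- upper Bohl exponent of a vector -/
def upperBohlVec {d : ℕ} (A : ℕ → (Euc d →L[ℝ] Euc d)) (x₀ : Euc d) : ℝ :=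
  ⨅ N : ℕ, sSup {r | ∃ n m : ℕ, N < n - m ∧ r = lam A n m x₀}

/-- lower Bohl exponent of a vector -/
def lowerBohlVec {d : ℕ} (A : ℕ → (Euc d →L[ℝ] Euc d)) (x₀ : Euc d) : ℝ :=
  ⨆ N : ℕ, sInf {r | ∃ n m : ℕ, N < n - m ∧ r = lam A n m x₀}

/-- Bohl spectrum -/
def bohlSpectrum {d : ℕ} (A : ℕ → (Euc d →L[ℝ] Euc d)) : Set ℝ :=
  {γ | ∃ x₀ : Euc d, x₀ ≠ 0 ∧ γ ∈ Set.Icc (lowerBohlVec A x₀) (upperBohlVec A x₀)}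

/-- the γ-shifted system `e^{-γ} A` -/
def shift {d : ℕ} (A : ℕ → (Euc d →L[ℝ] Euc d)) (γ : ℝ) : ℕ → (Euc d →L[ℝ] Euc d) :=
  fun n => Real.exp (-γ) • A n

/-- Bohl dichotomy on a given pair of subspaces -/
def HasBohlDichotomyOn {d : ℕ} (A : ℕ → (Euc d →L[ℝ] Euc d))
    (L₁ L₂ : Submodule ℝ (Euc d)) : Prop :=
  ∃ α : ℝ, 0 < α ∧ ∃ C₁ C₂ : Euc d → ℝ, (∀ x, 0 < C₁ x) ∧ (∀ x, 0 < C₂ x) ∧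
    (∀ x₀ ∈ L₁, ∀ m n : ℕ, m ≤ n →
      ‖sol A n x₀‖ ≤ C₁ x₀ * Real.exp (-α * ((n : ℝ) - (m : ℝ))) * ‖sol A m x₀‖) ∧
    (∀ x₀ ∈ L₂, ∀ m n : ℕ, m ≤ n →
      C₂ x₀ * Real.exp (α * ((n : ℝ) - (m : ℝ))) * ‖sol A m x₀‖ ≤ ‖sol A n x₀‖)

/-- Bohl dichotomy -/
def HasBohlDichotomy {d : ℕ} (A : ℕ → (Euc d →L[ℝ] Euc d)) : Prop :=
  ∃ L₁ L₂ : Submodule ℝ (Euc d), IsCompl L₁ L₂ ∧ HasBohlDichotomyOn A L₁ L₂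

/-- Bohl dichotomy spectrum -/
def bdSpectrum {d : ℕ} (A : ℕ → (Euc d →L[ℝ] Euc d)) : Set ℝ :=
  {γ | ¬ HasBohlDichotomy (shift A γ)}

/-- the γ-exponentially stable set -/
def Mset {d : ℕ} (A : ℕ → (Euc d →L[ℝ] Euc d)) (γ : ℝ) : Set (Euc d) :=
  {x₀ : Euc d | x₀ ≠ 0 ∧ upperBohlVec A x₀ < γ} ∪ {0}

theorem sol_succ_aux {d : ℕ} (A : ℕ → (Euc d →L[ℝ] Euc d)) (n : ℕ) (x : Euc d) :
    sol A (n + 1) x = A n (sol A n x) := by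
  simp [sol, fwd]

theorem lam_bdd_aux {d : ℕ} (A Ainv : ℕ → (Euc d →L[ℝ] Euc d)) (hA : IsLyapunov A Ainv)
    (x : Euc d) (hx : x ≠ 0) : ∃ C : ℝ, ∀ n m : ℕ, m < n → |lam A n m x| ≤ C := by
  obtain ⟨-, hinv, ⟨K₁, hK₁⟩, ⟨K₂, hK₂⟩⟩ := hA
  have b₁ : ∀ n, ‖A n‖ ≤ K₁ := fun n => hK₁ ⟨n, rfl⟩
  have b₂ : ∀ n, ‖Ainv n‖ ≤ K₂ := fun n => hK₂ ⟨n, rfl⟩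
  have back : ∀ n, Ainv n (sol A (n + 1) x) = sol A n x := by
    intro n
    rw [sol_succ_aux]
    have := congrArg (fun T : Euc d →L[ℝ] Euc d => T (sol A n x)) (hinv n)
    simpa using this
  have hne : ∀ n, sol A n x ≠ 0 := by
    intro n
    induction n with
    | zero => simpa [sol, fwd] using hx
    | succ n ih =>
      intro h
      apply ih
      rw [← back n, h, map_zero]
  have hpos : ∀ n, 0 < ‖sol A n x‖ := fun n => norm_pos_iff.mpr (hne n)
  let K : ℝ := max 1 (max K₁ K₂)
  have hK : 0 < K := lt_of_lt_of_le one_pos (le_max_left _ _)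
  have k₁ : K₁ ≤ K := le_trans (le_max_left _ _) (le_max_right _ _)
  have k₂ : K₂ ≤ K := le_trans (le_max_right _ _) (le_max_right _ _)
  have step : ∀ n, |Real.log ‖sol A (n + 1) x‖ - Real.log ‖sol A n x‖| ≤ Real.log K := by
    intro n
    have u : ‖sol A (n + 1) x‖ ≤ K * ‖sol A n x‖ := by
      rw [sol_succ_aux]
      exact (A n).le_of_opNorm_le ((b₁ n).trans k₁) _
    have l : ‖sol A n x‖ ≤ K * ‖sol A (n + 1) x‖ := by
      have := (Ainv n).le_of_opNorm_le ((b₂ n).trans k₂) (sol A (n + 1) x)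
      rwa [back] at this
    have u' := Real.log_le_log (hpos _) u
    have l' := Real.log_le_log (hpos _) l
    rw [Real.log_mul hK.ne' (hpos _).ne'] at u' l'
    rw [abs_le]
    constructor <;> linarith
  have many : ∀ m k : ℕ, |Real.log ‖sol A (m + k) x‖ - Real.log ‖sol A m x‖|
      ≤ Real.log K * k := by
    intro m k
    induction k with
    | zero => simp
    | succ k ih =>
      have s := step (m + k)
      rw [← add_assoc]
      rw [abs_le] at *
      push_cast
      constructor <;> linarith [s.1, s.2, ih.1, ih.2]
  refine ⟨Real.log K, fun n m hmn => ?_⟩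
  obtain ⟨k, rfl⟩ := Nat.exists_eq_add_of_lt hmn
  have := many m (k + 1)
  rw [← add_assoc] at this
  unfold lam
  rw [Real.log_div (hpos _).ne' (hpos _).ne', abs_div]
  have e : (((m + k + 1 : ℕ) : ℝ) - (m : ℝ)) = ((k + 1 : ℕ) : ℝ) := by push_cast; ring
  rw [e, abs_of_pos (by positivity : (0 : ℝ) < ((k + 1 : ℕ) : ℝ)),
    div_le_iff₀ (by positivity)]
  exact this

theorem lower_le_upper_aux {d : ℕ} (A Ainv : ℕ → (Euc d →L[ℝ] Euc d)) (hA : IsLyapunov A Ainv)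
    (x : Euc d) (hx : x ≠ 0) : lowerBohlVec A x ≤ upperBohlVec A x := by
  obtain ⟨C, hC⟩ := lam_bdd_aux A Ainv hA x hx
  refine ciSup_le fun N => le_ciInf fun M => ?_
  have h1 : sInf {r | ∃ n m : ℕ, N < n - m ∧ r = lam A n m x} ≤ lam A (max N M + 1) 0 x := by
    apply csInf_le
    · refine ⟨-C, ?_⟩
      rintro r ⟨n, m, h, rfl⟩
      exact (abs_le.mp (hC n m (by omega))).1
    · exact ⟨max N M + 1, 0, by omega, rfl⟩
  refine h1.trans ?_
  apply le_csSup
  · refine ⟨C, ?_⟩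
    rintro r ⟨n, m, h, rfl⟩
    exact (abs_le.mp (hC n m (by omega))).2
  · exact ⟨max N M + 1, 0, by omega, rfl⟩

theorem stmt13 {d : ℕ} (A Ainv : ℕ → (Euc d →L[ℝ] Euc d)) (hA : IsLyapunov A Ainv)
    (γ₁ γ₂ : ℝ) (h12 : γ₁ < γ₂)
    (h₁ : γ₁ ∉ bohlSpectrum A) (h₂ : γ₂ ∉ bohlSpectrum A) :
    (∀ γ ∈ Set.Icc γ₁ γ₂, γ ∉ bohlSpectrum A) ↔ Mset A γ₁ = Mset A γ₂ := by
  constructor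
  · intro h
    apply Set.Subset.antisymm
    · rintro x (⟨hx, hlt⟩ | hx)
      · exact Or.inl ⟨hx, hlt.trans h12⟩
      · exact Or.inr hx
    · rintro x (⟨hx, hlt⟩ | hx)
      · refine Or.inl ⟨hx, ?_⟩
        by_contra hge
        exact h _ ⟨not_lt.mp hge, hlt.le⟩
          ⟨x, hx, lower_le_upper_aux A Ainv hA x hx, le_rfl⟩
      · exact Or.inr hx
  · rintro hM γ ⟨hg1, hg2⟩ ⟨x, hx, hl, hu⟩
    have hlt : upperBohlVec A x < γ₂ := by
      by_contra hge
      exact h₂ ⟨x, hx, hl.trans hg2, not_lt.mp hge⟩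
    have hm : x ∈ Mset A γ₁ := by
      rw [hM]
      exact Or.inl ⟨hx, hlt⟩
    rcases hm with ⟨-, h⟩ | h
    · linarith
    · exact hx h
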